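/- Let X be a simple (q+1)-regular graph as in the context (so every vertex has degree q+1 and M = q+1), let α = (M + √(M² + 4M))/2, and fix vertices x₀ and x. Let μ_{x₀,x} be the complex measure ⟨E(·)δ_{x₀}, δ_x⟩ on the spectrum σ(Δ_X), where E is the spectral measure of the self-adjoint bounded operator Δ_X. Then for |u| < 1/α: Z_X(u, x₀, x) = (1−u²)^{−((q−1)/2)·δ_{x₀}(x)} · exp(−∫_{σ(Δ_X)} log(1 − ((q+1) − λ)u + qu²) dμ_{x₀,x}(λ)) · exp(Σ_{m=3}^{∞} (R_m(x₀, x)/m) u^m), where Z_X(u, x₀, x) = exp(Σ_{m=1}^{∞} (N_{X,m}(x₀, x)/m) u^m). -/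

import Mathlib

noncomputable section

/-- The Hilbert space `ℓ²(V)` of square-summable complex functions on `V`. -/
abbrev ℓ2 (V : Type) : Type := lp (fun _ : V => ℂ) 2

namespace SimpleGraph

variable {V : Type} (G : SimpleGraph V)

/-- The degree of a vertex. -/
def gdeg (v : V) : ℕ := Nat.card (G.neighborSet v)

/-- A geodesic (non-backtracking) path of length `m` in a simple graph,
encoded as its sequence of `m + 1` vertices. -/
def IsGeoPath {m : ℕ} (p : Fin (m + 1) → V) : Prop :=
  (∀ (i : ℕ) (h : i + 1 < m + 1), G.Adj (p ⟨i, by omega⟩) (p ⟨i + 1, h⟩)) ∧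
  (∀ (i : ℕ) (h : i + 2 < m + 1), p ⟨i + 2, h⟩ ≠ p ⟨i, by omega⟩)

/-- The number of geodesic loops (closed non-backtracking paths) of length `m`
at `x`. -/
def cLoop (m : ℕ) (x : V) : ℕ :=
  Nat.card {p : Fin (m + 1) → V // G.IsGeoPath p ∧ p 0 = x ∧ p (Fin.last m) = x}

/-- The formal combinatorial Laplacian applied to `cLoop m`:
`(Δ_X c_m)(x) = deg(x)·c_m(x) − Σ_{y ∼ x} c_m(y)`. -/
def lapc (m : ℕ) (x : V) : ℤ :=
  (G.gdeg x : ℤ) * G.cLoop m x - ∑ᶠ y ∈ G.neighborSet x, (G.cLoop m y : ℤ)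

/-- The defining property of the geodesic-path-counting operators `C_m` on
`ℓ²(V)`: `(C_m f)(x) = Σ_c f(t(c))`, the sum over all geodesic paths `c` of
length `m` starting at `x` (so `C₀ = I` and `C₁ = A_X`). -/
def IsGeoCountOp (C : ℕ → (ℓ2 V →L[ℂ] ℓ2 V)) : Prop :=
  ∀ (m : ℕ) (f : ℓ2 V) (x : V),
    C m f x =
      ∑ᶠ p : {p : Fin (m + 1) → V // G.IsGeoPath p ∧ p 0 = x}, f (p.1 (Fin.last m))

/-- The defining property of the adjacency operator on `ℓ²(V)`:
`(A f)(x) = Σ_{y ∼ x} f(y)`. -/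
def IsAdjOp (A : ℓ2 V →L[ℂ] ℓ2 V) : Prop :=
  ∀ (f : ℓ2 V) (x : V), A f x = ∑ᶠ y ∈ G.neighborSet x, f y

/-- The defining property of the valency operator on `ℓ²(V)`:
`(D f)(x) = deg(x)·f(x)`. -/
def IsValOp (D : ℓ2 V →L[ℂ] ℓ2 V) : Prop :=
  ∀ (f : ℓ2 V) (x : V), D f x = (G.gdeg x : ℂ) * f x

end SimpleGraph

/-- The `(x₀, x)` matrix entry of a bounded operator on `ℓ²(V)`:
`B(x₀, x) = (B δ_{x₀})(x)`, where `δ_{x₀}` is the Kronecker delta at `x₀`. -/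
def ent {V : Type} [DecidableEq V] (T : ℓ2 V →L[ℂ] ℓ2 V) (x₀ x : V) : ℂ :=
  T (lp.single 2 x₀ 1) x

/-- The power sums `a₁ ^ m + a₂ ^ m` of the roots of `t ^ 2 - a * t + q`, as polynomials in `a`. -/
def rootPowSum {R : Type*} [Ring R] (q : ℕ) (a : R) : ℕ → R
  | 0 => 2
  | 1 => a
  | m + 2 => a * rootPowSum q a (m + 1) - q * rootPowSum q a m

/-- Growth of a positive sequence dominated by a two-term recurrence. -/
lemma le_two_mul_pow_of_recurrence {c : ℕ → ℝ} {M q α : ℝ} (hM : 0 ≤ M) (hq : 0 ≤ q)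
    (hqM : q ≤ M) (hα : 0 ≤ α) (hα2 : α ^ 2 = M * α + M) (h1 : c 1 ≤ 2 * α)
    (h2 : c 2 ≤ 2 * α ^ 2) (h : ∀ m, c (m + 3) ≤ M * c (m + 2) + q * c (m + 1)) (m : ℕ) :
    c (m + 1) ≤ 2 * α ^ (m + 1) := by
  induction m using Nat.strong_induction_on with
  | _ m ih =>
    match m with
    | 0 => simpa using h1
    | 1 => exact h2
    | k + 2 =>
      have i1 := ih k (by omega)
      have i2 := ih (k + 1) (by omega)
      have hk : 0 ≤ α ^ (k + 1) := by positivity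
      calc c (k + 2 + 1) ≤ M * c (k + 2) + q * c (k + 1) := h k
        _ ≤ M * (2 * α ^ (k + 1 + 1)) + M * (2 * α ^ (k + 1)) := by
          have := mul_le_mul_of_nonneg_left i1 hq
          have := mul_le_mul_of_nonneg_right hqM (by positivity : 0 ≤ 2 * α ^ (k + 1))
          have := mul_le_mul_of_nonneg_left i2 hM
          linarith
        _ = 2 * α ^ (k + 1) * (M * α + M) := by ring
        _ = 2 * α ^ (k + 2 + 1) := by rw [← hα2]; ring

lemma norm_rootPowSum_le {q : ℕ} {a : ℂ} {α : ℝ} (hα : 0 ≤ α)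
    (hα2 : α ^ 2 = ((q : ℝ) + 1) * α + (q + 1)) (ha : ‖a‖ ≤ q + 1) (m : ℕ) :
    ‖rootPowSum q a (m + 1)‖ ≤ 2 * α ^ (m + 1) := by
  have hMα : (q : ℝ) + 1 ≤ α := by nlinarith [(Nat.cast_nonneg q : (0 : ℝ) ≤ q)]
  refine le_two_mul_pow_of_recurrence (c := fun m => ‖rootPowSum q a m‖) (M := q + 1) (q := q)
    (by positivity) (by positivity) (by linarith) hα hα2 ?_ ?_ (fun m => ?_) m
  · simp only [rootPowSum]; linarith
  · simp only [rootPowSum]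
    calc ‖a * a - q * 2‖ ≤ ‖a‖ * ‖a‖ + q * 2 := by
          refine (norm_sub_le _ _).trans (by simp)
      _ ≤ (q + 1) * (q + 1) + q * 2 := by gcongr
      _ ≤ 2 * α ^ 2 := by nlinarith [(Nat.cast_nonneg q : (0 : ℝ) ≤ q)]
  · rw [rootPowSum]
    refine (norm_sub_le _ _).trans ?_
    rw [norm_mul, norm_mul, Complex.norm_natCast]
    gcongr

lemma norm_mul_sub_lt_one {q : ℕ} {a u : ℂ} {α : ℝ} (hα : 0 < α)
    (hα2 : α ^ 2 = ((q : ℝ) + 1) * α + (q + 1)) (ha : ‖a‖ ≤ q + 1) (hu : ‖u‖ * α < 1) :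
    ‖a * u - q * u ^ 2‖ < 1 := by
  have h0 := norm_nonneg u
  have h : ‖a * u - q * u ^ 2‖ ≤ (q + 1) * ‖u‖ + q * ‖u‖ ^ 2 := by
    refine (norm_sub_le _ _).trans ?_
    rw [norm_mul, norm_mul, norm_pow, Complex.norm_natCast]
    gcongr
  have h2 : ((q + 1) * ‖u‖ + (q + 1) * ‖u‖ ^ 2) * α ^ 2 < 1 * α ^ 2 := by
    have : (‖u‖ * α) ^ 2 < 1 := by
      have : 0 ≤ ‖u‖ * α := by positivity
      nlinarith
    have e1 : ((q : ℝ) + 1) * ‖u‖ * α * α ≤ (q + 1) * α := by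
      nlinarith [mul_nonneg (by positivity : (0 : ℝ) ≤ (q + 1) * α) (sub_nonneg.2 hu.le)]
    nlinarith [(Nat.cast_nonneg q : (0 : ℝ) ≤ q)]
  have h3 := lt_of_mul_lt_mul_right h2 (by positivity)
  nlinarith [sq_nonneg ‖u‖]

lemma one_sub_mem_slitPlane {z : ℂ} (hz : ‖z‖ < 1) : 1 - z ∈ Complex.slitPlane := by
  left
  have := (Complex.abs_re_le_norm z)
  have := le_abs_self z.re
  simp only [Complex.sub_re, Complex.one_re]
  linarith

lemma tsum_rootPowSum {q : ℕ} {a u : ℂ} {α : ℝ} (hα : 0 < α)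
    (hα2 : α ^ 2 = ((q : ℝ) + 1) * α + (q + 1)) (ha : ‖a‖ ≤ q + 1) (hu : ‖u‖ * α < 1) :
    ∑' m : ℕ, rootPowSum q a (m + 1) / (m + 1) * u ^ (m + 1) =
      -Complex.log (1 - a * u + q * u ^ 2) := by
  obtain ⟨r, hur, hr⟩ := exists_between ((lt_div_iff₀ hα).2 hu)
  have hr' : r * α < 1 := (lt_div_iff₀ hα).1 hr
  have hr0 : 0 < r := (norm_nonneg u).trans_lt hur
  set t := Metric.ball (0 : ℂ) r
  have ht : ∀ y ∈ t, ‖y‖ * α < 1 := fun y hy => by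
    have : ‖y‖ < r := by simpa [t] using hy
    nlinarith
  have hbound : ∀ y ∈ t, ∀ n : ℕ, ‖rootPowSum q a (n + 1) * y ^ n‖ ≤ 2 * α * (r * α) ^ n := by
    intro y hy n
    have : ‖y‖ ≤ r := by simpa [t] using (Metric.ball_subset_closedBall hy)
    rw [norm_mul, norm_pow]
    calc _ ≤ 2 * α ^ (n + 1) * r ^ n := by
          gcongr; exact norm_rootPowSum_le hα.le hα2 ha n
      _ = _ := by ring
  have hsum : Summable fun n : ℕ => 2 * α * (r * α) ^ n :=
    (summable_geometric_of_lt_one (by positivity) hr').mul_left _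
  have hderiv : ∀ y ∈ t, HasDerivAt
      (fun z => ∑' m : ℕ, rootPowSum q a (m + 1) / (m + 1) * z ^ (m + 1))
      (∑' m : ℕ, rootPowSum q a (m + 1) * y ^ m) y := by
    intro y hy
    refine hasDerivAt_tsum_of_isPreconnected (y₀ := 0) hsum Metric.isOpen_ball
      (convex_ball _ _).isPreconnected (fun n y _ => ?_) (fun n y hy => hbound y hy n)
      (by simpa [t] using hr0) (by simp [summable_zero]) hy
    have hn : (n : ℂ) + 1 ≠ 0 := by exact_mod_cast n.succ_ne_zero
    convert! (hasDerivAt_pow (n + 1) y).const_mul (rootPowSum q a (n + 1) / (n + 1)) using 1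
    push_cast
    field_simp
  have hslit : ∀ y ∈ t, 1 - a * y + q * y ^ 2 ∈ Complex.slitPlane := by
    intro y hy
    convert one_sub_mem_slitPlane (norm_mul_sub_lt_one hα hα2 ha (ht y hy)) using 1
    ring
  have hlog : ∀ y ∈ t, HasDerivAt (fun z => Complex.log (1 - a * z + q * z ^ 2))
      ((-a + 2 * q * y) / (1 - a * y + q * y ^ 2)) y := by
    intro y hy
    refine HasDerivAt.clog ?_ (hslit y hy)
    convert! (((hasDerivAt_id y).const_mul a).const_sub 1).add
      ((hasDerivAt_pow 2 y).const_mul (q : ℂ)) using 1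
    push_cast
    ring
  have hgen : ∀ y ∈ t, (1 - a * y + q * y ^ 2) * ∑' m : ℕ, rootPowSum q a (m + 1) * y ^ m =
      a - 2 * q * y := by
    intro y hy
    have hs : Summable fun m : ℕ => rootPowSum q a (m + 1) * y ^ m :=
      Summable.of_norm_bounded hsum (hbound y hy)
    have h1 := hs.tsum_eq_zero_add
    have hs1 := (summable_nat_add_iff 1).2 hs
    have h2 := hs1.tsum_eq_zero_add
    have h3 : ∑' m : ℕ, rootPowSum q a (m + 1 + 1 + 1) * y ^ (m + 1 + 1) =
        a * y * (∑' m : ℕ, rootPowSum q a (m + 1 + 1) * y ^ (m + 1)) -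
          q * y ^ 2 * ∑' m : ℕ, rootPowSum q a (m + 1) * y ^ m := by
      rw [← tsum_mul_left, ← tsum_mul_left, ← (hs1.mul_left _).tsum_sub (hs.mul_left _)]
      refine tsum_congr fun m => ?_
      rw [rootPowSum]
      ring
    set S := ∑' m : ℕ, rootPowSum q a (m + 1) * y ^ m
    rw [h3] at h2
    simp only [rootPowSum, zero_add, pow_zero, pow_one, mul_one] at h1 h2
    set T := ∑' m : ℕ, rootPowSum q a (m + 1 + 1) * y ^ (m + 1)
    linear_combination (1 - a * y) * h1 + h2
  have hconst := Metric.isOpen_ball.is_const_of_deriv_eq_zero (𝕜 := ℂ)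
    (f := fun z => (∑' m : ℕ, rootPowSum q a (m + 1) / (m + 1) * z ^ (m + 1)) +
      Complex.log (1 - a * z + q * z ^ 2)) (s := t) (convex_ball _ _).isPreconnected
    (fun y hy => ((hderiv y hy).add (hlog y hy)).differentiableAt.differentiableWithinAt)
    (fun y hy => by
      refine ((hderiv y hy).add (hlog y hy)).deriv.trans ?_
      have h0 := Complex.slitPlane_ne_zero (hslit y hy)
      have := hgen y hy
      simp only [Pi.zero_apply]
      field_simp
      linear_combination this)
    (x := u) (y := 0) (by simpa [t] using hur) (by simpa [t] using hr0)
  simp only [ne_eq, Nat.add_eq_zero_iff, one_ne_zero, and_false, not_false_eq_true, zero_pow,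
    mul_zero, tsum_zero, sub_zero, OfNat.ofNat_ne_zero, add_zero, Complex.log_one] at hconst
  linear_combination hconst

namespace SimpleGraph

variable {V : Type} (G : SimpleGraph V)

/-- The geodesic paths of length `m + 1` whose first two vertices are `x` and `y`. -/
def geoPaths (m : ℕ) (x y : V) : Set (Fin (m + 2) → V) :=
  {p | G.IsGeoPath p ∧ p 0 = x ∧ p 1 = y}

/-- The sum of `f` over the endpoints of the geodesic paths of length `m + 1` starting with the
edge from `x` to `y`. -/
def geoSum (f : V → ℂ) (m : ℕ) (x y : V) : ℂ :=
  ∑ᶠ p ∈ G.geoPaths m x y, f (p (Fin.last (m + 1)))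

variable {G}

lemma isGeoPath_cons_iff {m : ℕ} {x : V} {p : Fin (m + 2) → V} :
    G.IsGeoPath (Fin.cons x p : Fin (m + 3) → V) ↔ G.Adj x (p 0) ∧ p 1 ≠ x ∧ G.IsGeoPath p := by
  constructor
  · rintro ⟨h1, h2⟩
    have e1 := h1 0 (by omega)
    have e2 := h2 0 (by omega)
    exact ⟨e1, e2, fun i h => h1 (i + 1) (by omega),
      fun i h => h2 (i + 1) (by omega)⟩
  · rintro ⟨h1, h2, h3, h4⟩
    refine ⟨fun i h => ?_, fun i h => ?_⟩
    · cases i with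
      | zero => exact h1
      | succ i => exact h3 i (by omega)
    · cases i with
      | zero => exact h2
      | succ i => exact h4 i (by omega)

lemma geoPaths_zero {x y : V} (h : G.Adj x y) : G.geoPaths 0 x y = {![x, y]} := by
  ext p
  simp only [geoPaths, Set.mem_ofPred_eq, Set.mem_singleton_iff]
  constructor
  · rintro ⟨-, h0, h1⟩
    ext i
    fin_cases i
    · exact h0
    · exact h1
  · rintro rfl
    refine ⟨⟨fun i hi => ?_, fun i hi => by omega⟩, rfl, rfl⟩
    obtain rfl : i = 0 := by omega
    exact h

lemma geoPaths_succ {x y : V} (h : G.Adj x y) (m : ℕ) :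
    G.geoPaths (m + 1) x y =
      (Fin.cons (α := fun _ => V) x : (Fin (m + 2) → V) → Fin (m + 3) → V) ''
        ⋃ z ∈ G.neighborSet y \ {x}, G.geoPaths m y z := by
  ext p
  simp only [geoPaths, Set.mem_ofPred_eq, Set.mem_image, Set.mem_iUnion, exists_prop]
  constructor
  · rintro ⟨hp, h0, h1⟩
    obtain ⟨a, p, rfl⟩ : ∃ a p', p = (Fin.cons a p' : Fin (m + 3) → V) :=
      ⟨p 0, Fin.tail p, (Fin.cons_self_tail p).symm⟩
    obtain rfl : a = x := h0
    replace h1 : p 0 = y := h1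
    obtain ⟨-, h3, h4⟩ := isGeoPath_cons_iff.1 hp
    refine ⟨p, ⟨p 1, ⟨?_, h3⟩, h4, h1, rfl⟩, rfl⟩
    have := h4.1 0 (by omega)
    rw [mem_neighborSet, ← h1]
    exact this
  · rintro ⟨p, ⟨z, ⟨-, hz⟩, hp, h0, h1⟩, rfl⟩
    refine ⟨isGeoPath_cons_iff.2 ⟨by rwa [h0], by rwa [h1], hp⟩, rfl, h0⟩

lemma pairwiseDisjoint_geoPaths (m : ℕ) (x : V) (s : Set V) :
    s.PairwiseDisjoint (G.geoPaths m x) := by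
  intro y _ z _ hyz
  refine Set.disjoint_left.2 fun p hp hp' => hyz ?_
  exact hp.2.2.symm.trans hp'.2.2

lemma finite_geoPaths (hfin : ∀ v, (G.neighborSet v).Finite) (m : ℕ) :
    ∀ {x y : V}, G.Adj x y → (G.geoPaths m x y).Finite := by
  induction m with
  | zero => intro x y h; rw [geoPaths_zero h]; exact Set.finite_singleton _
  | succ m ih =>
    intro x y h
    rw [geoPaths_succ h]
    exact (((hfin y).subset Set.sdiff_subset).biUnion fun z hz => ih hz.1).image _

lemma geoSum_zero (f : V → ℂ) {x y : V} (h : G.Adj x y) : G.geoSum f 0 x y = f y := by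
  rw [geoSum, geoPaths_zero h, finsum_mem_singleton]
  rfl

lemma geoSum_succ (hfin : ∀ v, (G.neighborSet v).Finite) (f : V → ℂ) (m : ℕ) {x y : V}
    (h : G.Adj x y) :
    G.geoSum f (m + 1) x y = ∑ᶠ z ∈ G.neighborSet y \ {x}, G.geoSum f m y z := by
  have hinj : Function.Injective (Fin.cons (α := fun _ => V) x : (Fin (m + 2) → V) → _) :=
    Fin.cons_right_injective (α := fun _ => V) x
  rw [geoSum, geoPaths_succ h, finsum_mem_image hinj.injOn,
    finsum_mem_biUnion (pairwiseDisjoint_geoPaths m y _) ((hfin y).subset Set.sdiff_subset)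
      fun z hz => finite_geoPaths hfin m hz.1]
  rfl

lemma finsum_mem_neighborSet_geoSum (hfin : ∀ v, (G.neighborSet v).Finite) (f : V → ℂ) (m : ℕ)
    {x y : V} (h : G.Adj x y) :
    ∑ᶠ z ∈ G.neighborSet y, G.geoSum f m y z = G.geoSum f (m + 1) x y + G.geoSum f m y x := by
  rw [geoSum_succ hfin f m h, add_comm,
    ← finsum_mem_insert (G.geoSum f m y) (by simp) ((hfin y).subset Set.sdiff_subset),
    Set.insert_sdiff_singleton, Set.insert_eq_of_mem ((G.mem_neighborSet y x).2 h.symm)]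

lemma geoPath_setOf_eq (m : ℕ) (x : V) :
    {p : Fin (m + 2) → V | G.IsGeoPath p ∧ p 0 = x} = ⋃ y ∈ G.neighborSet x, G.geoPaths m x y := by
  ext p
  simp only [geoPaths, Set.mem_ofPred_eq, Set.mem_iUnion, exists_prop]
  constructor
  · rintro ⟨hp, rfl⟩
    exact ⟨p 1, hp.1 0 (by omega), hp, rfl, rfl⟩
  · rintro ⟨y, -, hp, h0, -⟩
    exact ⟨hp, h0⟩

variable {A D : ℓ2 V →L[ℂ] ℓ2 V} {C : ℕ → (ℓ2 V →L[ℂ] ℓ2 V)}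

lemma IsGeoCountOp.apply_succ (hC : G.IsGeoCountOp C) (hfin : ∀ v, (G.neighborSet v).Finite)
    (m : ℕ) (f : ℓ2 V) (x : V) :
    C (m + 1) f x = ∑ᶠ y ∈ G.neighborSet x, G.geoSum f m x y := by
  rw [hC]
  refine (finsum_set_coe_eq_finsum_mem (f := fun p : Fin (m + 2) → V => f (p (Fin.last (m + 1))))
    {p : Fin (m + 2) → V | G.IsGeoPath p ∧ p 0 = x}).trans ?_
  rw [geoPath_setOf_eq, finsum_mem_biUnion (pairwiseDisjoint_geoPaths m x _) (hfin x)
      fun z hz => finite_geoPaths hfin m hz]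
  rfl

lemma IsGeoCountOp.zero (hC : G.IsGeoCountOp C) : C 0 = 1 := by
  ext f x
  rw [hC, finsum_eq_single _ ⟨fun _ => x, ⟨fun i h => by omega, fun i h => by omega⟩, rfl⟩]
  · rfl
  · rintro ⟨p, hp, h0⟩ hne
    refine absurd (Subtype.ext (funext fun i => ?_)) hne
    obtain rfl : i = 0 := by ext; omega
    exact h0

lemma IsGeoCountOp.one (hC : G.IsGeoCountOp C) (hfin : ∀ v, (G.neighborSet v).Finite)
    (hA : G.IsAdjOp A) : C 1 = A := by
  ext f x
  rw [hC.apply_succ hfin, hA]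
  exact finsum_mem_congr rfl fun y hy => geoSum_zero f hy

lemma natCast_ℓ2_apply (d : ℕ) (f : ℓ2 V) (x : V) :
    (d : ℓ2 V →L[ℂ] ℓ2 V) f x = d * f x := by
  have : (d : ℓ2 V →L[ℂ] ℓ2 V) f = (d : ℂ) • f := by
    rw [← nsmul_one, Nat.cast_smul_eq_nsmul]
    rfl
  rw [this]
  rfl

lemma IsValOp.eq_natCast (hD : G.IsValOp D) {d : ℕ} (hreg : ∀ v, G.gdeg v = d) :
    D = (d : ℓ2 V →L[ℂ] ℓ2 V) := by
  ext f x
  rw [hD, hreg, natCast_ℓ2_apply]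

lemma finsum_mem_neighborSet_const (hfin : ∀ v, (G.neighborSet v).Finite) (x : V) (c : ℂ) :
    ∑ᶠ _y ∈ G.neighborSet x, c = G.gdeg x * c := by
  rw [finsum_mem_eq_finite_toFinset_sum _ (hfin x), Finset.sum_const, nsmul_eq_mul, gdeg,
    Nat.card_coe_set_eq, Set.ncard_eq_toFinset_card _ (hfin x)]

lemma IsGeoCountOp.adj_mul (hC : G.IsGeoCountOp C) (hfin : ∀ v, (G.neighborSet v).Finite)
    (hA : G.IsAdjOp A) (m : ℕ) (f : ℓ2 V) (x : V) :
    (A * C (m + 1)) f x = C (m + 2) f x + ∑ᶠ y ∈ G.neighborSet x, G.geoSum f m y x := by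
  rw [mul_apply_eq_comp, hA, hC.apply_succ hfin,
    ← finsum_mem_add_distrib (hfin x)]
  refine finsum_mem_congr rfl fun y hy => ?_
  rw [hC.apply_succ hfin, finsum_mem_neighborSet_geoSum hfin f m hy]

lemma IsGeoCountOp.two (hC : G.IsGeoCountOp C) (hfin : ∀ v, (G.neighborSet v).Finite)
    (hA : G.IsAdjOp A) {d : ℕ} (hreg : ∀ v, G.gdeg v = d) : C 2 = A * A - d := by
  rw [eq_sub_iff_add_eq]
  symm
  ext f x
  have := hC.adj_mul hfin hA 0 f x
  rw [finsum_mem_congr rfl fun y (hy : y ∈ G.neighborSet x) => geoSum_zero f (G.adj_symm hy),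
    finsum_mem_neighborSet_const hfin, hreg, zero_add, hC.one hfin hA] at this
  rw [this, ← natCast_ℓ2_apply]
  rfl

lemma IsGeoCountOp.add_three (hC : G.IsGeoCountOp C) (hfin : ∀ v, (G.neighborSet v).Finite)
    (hA : G.IsAdjOp A) {q : ℕ} (hreg : ∀ v, G.gdeg v = q + 1) (m : ℕ) :
    C (m + 3) = A * C (m + 2) - q * C (m + 1) := by
  rw [eq_sub_iff_add_eq]
  symm
  ext f x
  have h1 := hC.adj_mul hfin hA (m + 1) f x
  have h2 : ∑ᶠ y ∈ G.neighborSet x, G.geoSum f (m + 1) y x = q * C (m + 1) f x := by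
    have h3 : ∀ y ∈ G.neighborSet x, G.geoSum f (m + 1) y x =
        C (m + 1) f x - G.geoSum f m x y := fun y hy => by
      rw [hC.apply_succ hfin, finsum_mem_neighborSet_geoSum hfin f m (G.adj_symm hy)]
      ring
    rw [finsum_mem_congr rfl h3, finsum_mem_sub_distrib _ _ (hfin x),
      finsum_mem_neighborSet_const hfin, ← hC.apply_succ hfin, hreg]
    push_cast
    ring
  rw [h1, h2, ← natCast_ℓ2_apply]
  rfl

end SimpleGraph

namespace SimpleGraph

variable {V : Type} {G : SimpleGraph V} {A : ℓ2 V →L[ℂ] ℓ2 V}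

lemma card_toFinset_neighborSet (hfin : ∀ v, (G.neighborSet v).Finite) (x : V) :
    (hfin x).toFinset.card = G.gdeg x := by
  rw [gdeg, Nat.card_coe_set_eq, Set.ncard_eq_toFinset_card _ (hfin x)]

lemma IsAdjOp.norm_le (hA : G.IsAdjOp A) (hfin : ∀ v, (G.neighborSet v).Finite) {d : ℕ}
    (hreg : ∀ v, G.gdeg v = d) : ‖A‖ ≤ d := by
  classical
  refine A.opNorm_le_bound (by positivity) fun f => ?_
  refine lp.norm_le_of_forall_sum_le (by simp) (by positivity) fun s => ?_
  simp only [ENNReal.toReal_ofNat, Real.rpow_ofNat]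
  have hpt : ∀ x, ‖A f x‖ ^ 2 ≤ d * ∑ y ∈ (hfin x).toFinset, ‖f y‖ ^ 2 := by
    intro x
    rw [hA, finsum_mem_eq_finite_toFinset_sum _ (hfin x), ← hreg x,
      ← card_toFinset_neighborSet hfin x]
    refine le_trans ?_ sq_sum_le_card_mul_sum_sq
    gcongr
    exact norm_sum_le _ _
  have hl : ∑ y ∈ s.biUnion fun x => (hfin x).toFinset, ‖f y‖ ^ 2 ≤ ‖f‖ ^ 2 := by
    simpa using lp.sum_rpow_le_norm_rpow (by simp) f (s.biUnion fun x => (hfin x).toFinset)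
  calc ∑ x ∈ s, ‖A f x‖ ^ 2 ≤ ∑ x ∈ s, d * ∑ y ∈ (hfin x).toFinset, ‖f y‖ ^ 2 :=
        Finset.sum_le_sum fun x _ => hpt x
    _ = d * ∑ x ∈ s, ∑ y ∈ (hfin x).toFinset, ‖f y‖ ^ 2 := by rw [Finset.mul_sum]
    _ = d * ∑ y ∈ s.biUnion fun x => (hfin x).toFinset,
          ∑ x ∈ s with y ∈ (hfin x).toFinset, ‖f y‖ ^ 2 := by
        congr 1
        refine Finset.sum_comm' fun x y => ?_
        simp only [Finset.mem_filter, Finset.mem_biUnion]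
        exact ⟨fun h => ⟨h, x, h⟩, fun h => h.1⟩
    _ ≤ d * ∑ y ∈ s.biUnion fun x => (hfin x).toFinset, d * ‖f y‖ ^ 2 := by
        gcongr with y hy
        rw [Finset.sum_const, nsmul_eq_mul]
        gcongr
        rw [← hreg y, ← card_toFinset_neighborSet hfin y]
        refine Finset.card_le_card fun x hx => ?_
        simp only [Finset.mem_filter, Set.Finite.mem_toFinset] at hx ⊢
        exact G.adj_symm hx.2
    _ = d ^ 2 * ∑ y ∈ s.biUnion fun x => (hfin x).toFinset, ‖f y‖ ^ 2 := by
        rw [← Finset.mul_sum]; ring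
    _ ≤ d ^ 2 * ‖f‖ ^ 2 := by gcongr
    _ = (d * ‖f‖) ^ 2 := by ring

lemma IsAdjOp.isSelfAdjoint (hA : G.IsAdjOp A) (hfin : ∀ v, (G.neighborSet v).Finite) :
    IsSelfAdjoint A := by
  classical
  have hAs : ∀ i x, A (lp.single 2 i 1) x = if G.Adj x i then 1 else 0 := by
    intro i x
    rw [hA, finsum_mem_eq_finite_toFinset_sum _ (hfin x)]
    simp [lp.single_apply, Pi.single_apply, Finset.sum_ite_eq']
  rw [ContinuousLinearMap.isSelfAdjoint_iff', eq_comm]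
  refine lp.ext_continuousLinearMap (by simp) fun i => ?_
  ext x
  simp only [ContinuousLinearMap.comp_apply, lp.singleContinuousLinearMap_apply]
  have h : ∀ g : ℓ2 V, g x = inner ℂ (lp.single 2 x (1 : ℂ)) g := fun g => by
    simp [lp.inner_single_left]
  rw [h (ContinuousLinearMap.adjoint A _), ContinuousLinearMap.adjoint_inner_right,
    lp.inner_single_right, hAs, hAs]
  simp [G.adj_comm]

end SimpleGraph

lemma sum_Icc_half_add_two {R : Type*} [AddCommMonoid R] (c : ℕ → R) (m : ℕ) :
    ∑ j ∈ Finset.Icc 1 ((m + 2) / 2), c (m + 2 - 2 * j) =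
      c m + ∑ j ∈ Finset.Icc 1 (m / 2), c (m - 2 * j) := by
  rw [← Finset.Ico_add_one_right_eq_Icc, ← Finset.Ico_add_one_right_eq_Icc,
    Finset.sum_Ico_eq_sum_range, Finset.sum_Ico_eq_sum_range, Nat.add_div_right _ two_pos,
    Nat.add_sub_cancel, Nat.add_sub_cancel, Finset.sum_range_succ', add_comm]
  congr 1
  refine Finset.sum_congr rfl fun j _ => ?_
  congr 1
  omega

lemma sub_mul_sum_eq_rootPowSum {R : Type*} [Ring R] {q : ℕ} {a : R} {c : ℕ → R}
    (h0 : c 0 = 1) (h1 : c 1 = a) (h2 : c 2 = a * a - (q + 1))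
    (h : ∀ m, c (m + 3) = a * c (m + 2) - q * c (m + 1)) (m : ℕ) :
    c (m + 1) - (q - 1) * ∑ j ∈ Finset.Icc 1 ((m + 1) / 2), c (m + 1 - 2 * j) =
      rootPowSum q a (m + 1) := by
  set s : ℕ → R := fun m => ∑ j ∈ Finset.Icc 1 (m / 2), c (m - 2 * j) with hs
  have s2 : ∀ m, s (m + 2) = c m + s m := sum_Icc_half_add_two c
  have s0 : s 0 = 0 := by simp [hs]
  have s1 : s 1 = 0 := by simp [hs]
  have hsrec : ∀ m, s (m + 3) = a * s (m + 2) - q * s (m + 1) := by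
    intro m
    induction m using Nat.strong_induction_on with
    | _ m ih =>
      match m with
      | 0 => rw [s2 1, s2 0, s1, s0, h1, h0]; simp
      | 1 => rw [s2 2, s2 1, s2 0, s1, s0, h2, h1, h0]; noncomm_ring
      | k + 2 =>
        have e := ih k (by omega)
        rw [s2 (k + 1)] at e
        rw [s2 (k + 3), s2 (k + 2), s2 (k + 1), h]
        nth_rewrite 1 [e]
        noncomm_ring
  change c (m + 1) - (q - 1) * s (m + 1) = _
  induction m using Nat.strong_induction_on with
  | _ m ih =>
    match m with
    | 0 => simp [s1, h1, rootPowSum]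
    | 1 =>
      simp only [Nat.reduceAdd, s2 0, s0, h2, h0, rootPowSum]
      noncomm_ring
    | k + 2 =>
      rw [rootPowSum, ← ih k (by omega), ← ih (k + 1) (by omega), hsrec, h]
      have e : a * ((q - 1) * s (k + 2)) = (q - 1) * (a * s (k + 2)) := by
        rw [← mul_assoc, ← mul_assoc,
          (((Nat.cast_commute q a).sub_left (Commute.one_left a)).eq)]
      rw [mul_sub a, e]
      noncomm_ring

lemma continuous_rootPowSum (q : ℕ) (m : ℕ) : Continuous fun a : ℂ => rootPowSum q a m := by
  induction m using Nat.strong_induction_on with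
  | _ m ih =>
    match m with
    | 0 => simpa only [rootPowSum] using continuous_const
    | 1 => simpa only [rootPowSum] using! continuous_id
    | k + 2 =>
      simp only [rootPowSum]
      exact (continuous_id.mul (ih (k + 1) (by omega))).sub
        (continuous_const.mul (ih k (by omega)))

section CStarAlgebra

variable {𝓐 : Type*} [CStarAlgebra 𝓐]

lemma cfc_rootPowSum (q : ℕ) (c : ℂ) (T : 𝓐) [IsStarNormal T] (m : ℕ) :
    cfc (fun z : ℂ => rootPowSum q (c - z) m) T = rootPowSum q (algebraMap ℂ 𝓐 c - T) m := by
  have hcont : ∀ m, ContinuousOn (fun z : ℂ => rootPowSum q (c - z) m) (spectrum ℂ T) :=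
    fun m => ((continuous_rootPowSum q m).comp (continuous_const.sub continuous_id)).continuousOn
  have hlin : cfc (fun z : ℂ => c - z) T = algebraMap ℂ 𝓐 c - T := by
    rw [cfc_sub (fun _ => c) (fun z => z) T, cfc_const c T, cfc_id' ℂ T]
  induction m using Nat.strong_induction_on with
  | _ m ih =>
    match m with
    | 0 =>
      simp only [rootPowSum]
      rw [cfc_const 2 T, map_ofNat]
    | 1 => simpa only [rootPowSum] using hlin
    | k + 2 =>
      simp only [rootPowSum]
      have hc : ContinuousOn (fun z : ℂ => c - z) (spectrum ℂ T) := by fun_prop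
      have hk := hcont k
      have hk1 := hcont (k + 1)
      rw [cfc_sub (fun z => (c - z) * rootPowSum q (c - z) (k + 1))
          (fun z => q * rootPowSum q (c - z) k) T (hc.mul hk1) (continuousOn_const.mul hk),
        cfc_mul _ _ T hc hk1, cfc_const_mul _ _ T hk, hlin, ih k (by omega), ih (k + 1) (by omega),
        Nat.cast_smul_eq_nsmul, nsmul_eq_mul]

lemma hasSum_rootPowSum_cfc {q : ℕ} {c u : ℂ} {α : ℝ} (hα : 0 < α)
    (hα2 : α ^ 2 = ((q : ℝ) + 1) * α + (q + 1)) (hu : ‖u‖ * α < 1) (T : 𝓐) [IsStarNormal T]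
    (hT : ∀ z ∈ spectrum ℂ T, ‖c - z‖ ≤ q + 1) :
    HasSum (fun m : ℕ => (u ^ (m + 1) / (m + 1)) • rootPowSum q (algebraMap ℂ 𝓐 c - T) (m + 1))
      (-cfc (fun z : ℂ => Complex.log (1 - (c - z) * u + q * u ^ 2)) T) := by
  have hpow : ∀ m : ℕ, ContinuousOn (fun z : ℂ => rootPowSum q (c - z) (m + 1))
      (spectrum ℂ T) := fun m =>
    ((continuous_rootPowSum q (m + 1)).comp (continuous_const.sub continuous_id)).continuousOn
  have hcont : ∀ m : ℕ, ContinuousOn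
      (fun z : ℂ => u ^ (m + 1) / (m + 1) * rootPowSum q (c - z) (m + 1)) (spectrum ℂ T) :=
    fun m => continuousOn_const.mul (hpow m)
  have hlim : TendstoUniformlyOn
      (fun (t : Finset ℕ) z => ∑ m ∈ t, u ^ (m + 1) / (m + 1) * rootPowSum q (c - z) (m + 1))
      (fun z => ∑' m : ℕ, u ^ (m + 1) / (m + 1) * rootPowSum q (c - z) (m + 1)) Filter.atTop
      (spectrum ℂ T) := by
    refine tendstoUniformlyOn_tsum (u := fun m : ℕ => 2 * (‖u‖ * α) ^ (m + 1)) ?_ ?_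
    · exact ((summable_nat_add_iff 1).2
        (summable_geometric_of_lt_one (by positivity) hu)).mul_left _
    · intro m z hz
      rw [norm_mul, norm_div, norm_pow]
      have hm : (1 : ℝ) ≤ ‖(m : ℂ) + 1‖ := by
        have : ‖((m + 1 : ℕ) : ℂ)‖ = ((m + 1 : ℕ) : ℝ) := Complex.norm_natCast _
        push_cast at this
        rw [this]
        linarith [(Nat.cast_nonneg m : (0 : ℝ) ≤ m)]
      calc _ ≤ ‖u‖ ^ (m + 1) * (2 * α ^ (m + 1)) := by
            gcongr
            · exact div_le_self (by positivity) hm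
            · exact norm_rootPowSum_le hα.le hα2 (hT z hz) m
        _ = _ := by ring
  have h := tendsto_cfc_fun hlim (Filter.Eventually.of_forall fun t =>
    continuousOn_finsetSum t fun m _ => hcont m)
  rw [← cfc_neg]
  rw [cfc_congr (g := fun z => -Complex.log (1 - (c - z) * u + q * u ^ 2))] at h
  · refine h.congr fun t => ?_
    refine Eq.trans (congrArg (cfc · T) (funext fun z => (Finset.sum_apply z t
      fun m z => u ^ (m + 1) / (m + 1) * rootPowSum q (c - z) (m + 1)).symm)) ?_
    rw [cfc_sum _ _ _ fun m _ => hcont m]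
    refine Finset.sum_congr rfl fun m _ => ?_
    rw [cfc_const_mul _ _ T (hpow m), cfc_rootPowSum]
  · intro z hz
    refine Eq.trans (tsum_congr fun m => ?_) (tsum_rootPowSum hα hα2 (hT z hz) hu)
    ring

end CStarAlgebra

lemma HasSum.of_forall_eq {f g : ℕ → ℂ} {a : ℂ} (h : HasSum f a) (e : ∀ n, g n = f n) :
    HasSum g a := by
  rwa [funext e]

lemma hasSum_even_pow {u : ℂ} (hu : ‖u‖ < 1) (c : ℂ) :
    HasSum (fun m : ℕ => (if Even (m + 1) then c else 0) / (m + 1) * u ^ (m + 1))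
      (Complex.log (1 - u ^ 2) * (-(c / 2))) := by
  have hu2 : ‖u ^ 2‖ < 1 := by
    rw [norm_pow]; exact pow_lt_one₀ (norm_nonneg _) hu two_ne_zero
  have h1 := (Complex.hasSum_taylorSeries_neg_log hu2).mul_left (c / 2)
  have h2 : HasSum (fun m : ℕ => (if Even m then c else 0) / m * u ^ m)
      (c / 2 * -Complex.log (1 - u ^ 2)) := by
    refine (Function.Injective.hasSum_iff (mul_right_injective₀ (two_ne_zero' ℕ)) ?_).1
      ?_
    · intro m hm
      rw [if_neg fun he => hm ?_]
      · simp
      · obtain ⟨k, rfl⟩ := he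
        exact ⟨k, by ring⟩
    · refine HasSum.of_forall_eq h1 fun n => ?_
      simp only [Function.comp_apply, even_two_mul, if_true, pow_mul]
      push_cast
      ring
  have h3 := (hasSum_nat_add_iff' 1).2 h2
  convert! h3 using 1
  · ext m; push_cast; rfl
  · simp; ring

namespace SimpleGraph

variable {V : Type} {G : SimpleGraph V} {A : ℓ2 V →L[ℂ] ℓ2 V} {C : ℕ → (ℓ2 V →L[ℂ] ℓ2 V)}

lemma finsum_mem_one_eq_ncard {ι : Type*} (s : Set ι) : ∑ᶠ i ∈ s, (1 : ℂ) = s.ncard := by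
  rcases s.finite_or_infinite with hs | hs
  · rw [finsum_mem_eq_finite_toFinset_sum _ hs, Set.ncard_eq_toFinset_card s hs]
    simp
  · rw [hs.ncard, finsum_mem_eq_zero_of_infinite
      (by simpa [Function.support_const one_ne_zero] using hs), Nat.cast_zero]

lemma IsGeoCountOp.ent_self [DecidableEq V] (hC : G.IsGeoCountOp C) (m : ℕ) (x : V) :
    ent (C m) x x = G.cLoop m x := by
  have h : ∀ p : Fin (m + 1) → V, (lp.single 2 x (1 : ℂ) : ℓ2 V) (p (Fin.last m)) =
      if p (Fin.last m) = x then 1 else 0 := fun p => by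
    simp [lp.single_apply, Pi.single_apply]
  rw [ent, hC]
  refine (finsum_set_coe_eq_finsum_mem
    (f := fun p : Fin (m + 1) → V => (lp.single 2 x (1 : ℂ) : ℓ2 V) (p (Fin.last m)))
    {p : Fin (m + 1) → V | G.IsGeoPath p ∧ p 0 = x}).trans ?_
  change _ = ((Nat.card
    {p : Fin (m + 1) → V | G.IsGeoPath p ∧ p 0 = x ∧ p (Fin.last m) = x} : ℕ) : ℂ)
  rw [Nat.card_coe_set_eq]
  refine Eq.trans (finsum_congr fun p => ?_) (finsum_mem_one_eq_ncard _)
  classical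
  rw [h, finsum_eq_if, finsum_eq_if]
  simp only [Set.mem_ofPred_eq, ← and_assoc, ite_and]

lemma norm_ent_le [DecidableEq V] (T : ℓ2 V →L[ℂ] ℓ2 V) (x₀ x : V) : ‖ent T x₀ x‖ ≤ ‖T‖ := by
  refine (lp.norm_apply_le_norm two_ne_zero _ _).trans ((T.le_opNorm _).trans ?_)
  rw [lp.norm_single (by simp), norm_one, mul_one]

lemma norm_natCast_ℓ2_le (d : ℕ) : ‖(d : ℓ2 V →L[ℂ] ℓ2 V)‖ ≤ d := by
  refine (Nat.norm_cast_le d).trans ?_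
  exact mul_le_of_le_one_right d.cast_nonneg ContinuousLinearMap.norm_id_le

lemma IsGeoCountOp.norm_le (hC : G.IsGeoCountOp C) (hfin : ∀ v, (G.neighborSet v).Finite)
    (hA : G.IsAdjOp A) {q : ℕ} (hreg : ∀ v, G.gdeg v = q + 1) {α : ℝ} (hα : 0 ≤ α)
    (hα2 : α ^ 2 = ((q : ℝ) + 1) * α + (q + 1)) (m : ℕ) :
    ‖C (m + 1)‖ ≤ 2 * α ^ (m + 1) := by
  have hMα : (q : ℝ) + 1 ≤ α := by nlinarith [(Nat.cast_nonneg q : (0 : ℝ) ≤ q)]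
  have hnA : ‖A‖ ≤ (q : ℝ) + 1 := by exact_mod_cast hA.norm_le hfin hreg
  refine le_two_mul_pow_of_recurrence (c := fun m => ‖C m‖) (M := q + 1) (q := q)
    (by positivity) (by positivity) (by linarith) hα hα2 ?_ ?_ (fun m => ?_) m
  · simp only [hC.one hfin hA]; linarith
  · simp only [hC.two hfin hA hreg]
    refine (norm_sub_le _ _).trans ?_
    have h1 : ‖A * A‖ ≤ (q + 1) * (q + 1) := (norm_mul_le _ _).trans (by gcongr)
    have h2 := norm_natCast_ℓ2_le (V := V) (q + 1)
    push_cast at h2 ⊢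
    nlinarith
  · simp only [hC.add_three hfin hA hreg m]
    refine (norm_sub_le _ _).trans (add_le_add ?_ ?_)
    · exact (norm_mul_le _ _).trans (by gcongr)
    · refine (norm_mul_le _ _).trans ?_
      gcongr
      exact norm_natCast_ℓ2_le q

lemma IsGeoCountOp.abs_lapc_le (hC : G.IsGeoCountOp C) (hfin : ∀ v, (G.neighborSet v).Finite)
    (hA : G.IsAdjOp A) {q : ℕ} (hreg : ∀ v, G.gdeg v = q + 1) {α : ℝ} (hα : 0 ≤ α)
    (hα2 : α ^ 2 = ((q : ℝ) + 1) * α + (q + 1)) (m : ℕ) (x : V) :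
    |(G.lapc (m + 1) x : ℝ)| ≤ 4 * (q + 1) * α ^ (m + 1) := by
  classical
  have hc : ∀ y, (G.cLoop (m + 1) y : ℝ) ≤ 2 * α ^ (m + 1) := fun y => by
    have h := (norm_ent_le (C (m + 1)) y y).trans (hC.norm_le hfin hA hreg hα hα2 m)
    rwa [hC.ent_self, Complex.norm_natCast] at h
  rw [lapc, finsum_mem_eq_finite_toFinset_sum _ (hfin x), hreg]
  push_cast
  have h1 : ∑ y ∈ (hfin x).toFinset, (G.cLoop (m + 1) y : ℝ) ≤
      (q + 1) * (2 * α ^ (m + 1)) := by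
    refine (Finset.sum_le_sum fun y _ => hc y).trans ?_
    rw [Finset.sum_const, card_toFinset_neighborSet, hreg, nsmul_eq_mul]
    push_cast
    rfl
  have h2 : 0 ≤ ∑ y ∈ (hfin x).toFinset, (G.cLoop (m + 1) y : ℝ) :=
    Finset.sum_nonneg fun _ _ => Nat.cast_nonneg _
  have h3 : ((q : ℝ) + 1) * G.cLoop (m + 1) x ≤ (q + 1) * (2 * α ^ (m + 1)) :=
    mul_le_mul_of_nonneg_left (hc x) (by positivity)
  have h4 : 0 ≤ ((q : ℝ) + 1) * G.cLoop (m + 1) x := by positivity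
  rw [abs_le]
  constructor <;> nlinarith

lemma IsGeoCountOp.norm_sum_mul_lapc_le (hC : G.IsGeoCountOp C)
    (hfin : ∀ v, (G.neighborSet v).Finite) (hA : G.IsAdjOp A) {q : ℕ}
    (hreg : ∀ v, G.gdeg v = q + 1) {α : ℝ} (hα : 1 ≤ α)
    (hα2 : α ^ 2 = ((q : ℝ) + 1) * α + (q + 1)) (m : ℕ) (x : V) :
    ‖∑ j ∈ Finset.Icc 1 ((m + 1) / 2 - 1), (j : ℂ) * (G.lapc (m - 2 * j) x : ℂ)‖ ≤
      4 * (q + 1) * (m ^ 2 * α ^ m) := by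
  calc _ ≤ ∑ j ∈ Finset.Icc 1 ((m + 1) / 2 - 1), (m : ℝ) * (4 * (q + 1) * α ^ m) := by
        refine norm_sum_le_of_le _ fun j hj => ?_
        rw [Finset.mem_Icc] at hj
        obtain ⟨k, hk⟩ : ∃ k, m - 2 * j = k + 1 := ⟨m - 2 * j - 1, by omega⟩
        rw [norm_mul, Complex.norm_natCast, Complex.norm_intCast, hk]
        have h1 := hC.abs_lapc_le hfin hA hreg (zero_le_one.trans hα) hα2 k x
        have h2 : α ^ (k + 1) ≤ α ^ m := pow_le_pow_right₀ hα (by omega)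
        have h3 : (j : ℝ) ≤ m := by exact_mod_cast (by omega : j ≤ m)
        refine mul_le_mul h3 (h1.trans ?_) (abs_nonneg _) (Nat.cast_nonneg _)
        gcongr
    _ ≤ (m : ℝ) * (m * (4 * (q + 1) * α ^ m)) := by
        rw [Finset.sum_const, nsmul_eq_mul]
        gcongr
        simp
        omega
    _ = _ := by ring

/-- The matrix entry at `(x₀, x)` as a continuous linear functional. -/
def entCLM [DecidableEq V] (x₀ x : V) : (ℓ2 V →L[ℂ] ℓ2 V) →L[ℂ] ℂ :=
  (lp.evalCLM ℂ (fun _ : V => ℂ) 2 x).comp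
    (ContinuousLinearMap.apply ℂ (ℓ2 V) (lp.single 2 x₀ (1 : ℂ)))

lemma entCLM_apply [DecidableEq V] (x₀ x : V) (T : ℓ2 V →L[ℂ] ℓ2 V) :
    entCLM x₀ x T = ent T x₀ x := rfl

end SimpleGraph

lemma cpow_mul_exp_eq {w a b c : ℂ} (hw : w ≠ 0) :
    w ^ a * Complex.exp b * Complex.exp c = Complex.exp (b + (Complex.log w * a + c)) := by
  rw [Complex.cpow_def_of_ne_zero hw, ← Complex.exp_add, ← Complex.exp_add]
  ring_nf

/-- Corollary 4.5 of the paper, for a `(q+1)`-regular simple graph (so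
`M = q + 1`): for `|u| < 1/α`,

`Z_X(u,x₀,x) = (1−u²)^{−((q−1)/2)·δ_{x₀}(x)}
 · exp(−∫_{σ(Δ_X)} log(1 − ((q+1) − λ)u + qu²) dμ_{x₀,x}(λ))
 · exp(Σ_{m≥3} R_m(x₀,x)/m · u^m)`,

where `Z_X(u,x₀,x) = exp(Σ_{m≥1} N_{X,m}(x₀,x)/m · u^m)` and
`μ_{x₀,x} = ⟨E(·)δ_{x₀}, δ_x⟩` is the spectral measure of the bounded
self-adjoint operator `Δ_X = D_X − A_X` paired at `(x₀, x)`.  The spectral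
integral `∫_{σ(Δ_X)} g dμ_{x₀,x} = ⟨g(Δ_X)δ_{x₀}, δ_x⟩` is formalized as the
`(x₀, x)` matrix entry of the (continuous) functional calculus of `Δ_X`
applied to `λ ↦ log(1 − ((q+1) − λ)u + qu²)`. -/
theorem Ihara_formula_regular {V : Type} [DecidableEq V]
    (G : SimpleGraph V) [Countable V]
    (hconn : G.Connected)
    (hfin : ∀ v : V, (G.neighborSet v).Finite)
    (q : ℕ) (hq : 1 ≤ q)
    (hreg : ∀ v : V, G.gdeg v = q + 1)
    (A D : ℓ2 V →L[ℂ] ℓ2 V) (hA : G.IsAdjOp A) (hD : G.IsValOp D)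
    (C : ℕ → (ℓ2 V →L[ℂ] ℓ2 V)) (hC : G.IsGeoCountOp C)
    (B : ℕ → (ℓ2 V →L[ℂ] ℓ2 V))
    (hB_small : ∀ m : ℕ, m ≤ 2 → B m = C m)
    (hB : ∀ m : ℕ, 3 ≤ m →
      B m = C m - ((D - 1) - 1) * ∑ j ∈ Finset.Icc 1 (m / 2), C (m - 2 * j))
    (R : ℕ → (ℓ2 V →L[ℂ] ℓ2 V))
    (hR_small : ∀ m : ℕ, m ≤ 2 → R m = 0)
    (hR : ∀ m : ℕ, 3 ≤ m → ∀ (f : ℓ2 V) (x : V),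
      R m f x =
        (∑ j ∈ Finset.Icc 1 ((m + 1) / 2 - 1), (j : ℂ) * (G.lapc (m - 2 * j) x : ℂ)) * f x)
    (Rp : ℕ → (ℓ2 V →L[ℂ] ℓ2 V))
    (hRp_small : ∀ m : ℕ, m ≤ 2 → Rp m = 0)
    (hRp : ∀ m : ℕ, 3 ≤ m →
      Rp m = (if Even m then ((D - 1) - 1) else 0) + R m)
    (NX : ℕ → (ℓ2 V →L[ℂ] ℓ2 V)) (hNX : ∀ m : ℕ, NX m = B m + Rp m)
    (x₀ x : V)
    (u : ℂ)
    (hu : ‖u‖ < 1 / ((((q : ℝ) + 1) +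
      Real.sqrt (((q : ℝ) + 1) ^ 2 + 4 * ((q : ℝ) + 1))) / 2)) :
    Complex.exp (∑' m : ℕ, ent (NX (m + 1)) x₀ x / ((m : ℂ) + 1) * u ^ (m + 1)) =
      (1 - u ^ 2) ^ (-(((q : ℂ) - 1) / 2) * (if x = x₀ then (1 : ℂ) else 0)) *
        Complex.exp
          (-(ent (cfc (fun lam : ℂ =>
              Complex.log (1 - (((q : ℂ) + 1) - lam) * u + (q : ℂ) * u ^ 2)) (D - A))
            x₀ x)) *
        Complex.exp (∑' m : ℕ, ent (R (m + 3)) x₀ x / ((m : ℂ) + 3) * u ^ (m + 3)) := by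
  set α : ℝ := (((q : ℝ) + 1) + Real.sqrt (((q : ℝ) + 1) ^ 2 + 4 * ((q : ℝ) + 1))) / 2 with hαdef
  have hα2 : α ^ 2 = ((q : ℝ) + 1) * α + (q + 1) := by
    have := Real.sq_sqrt (by positivity : 0 ≤ ((q : ℝ) + 1) ^ 2 + 4 * ((q : ℝ) + 1))
    rw [hαdef]
    linear_combination this / 4
  have hα0 : 0 < α := by positivity
  have hα1 : 1 ≤ α := by nlinarith [(Nat.cast_nonneg q : (0 : ℝ) ≤ q)]
  have hu' : ‖u‖ * α < 1 := (lt_div_iff₀ hα0).1 hu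
  have hu1 : ‖u‖ < 1 := by nlinarith [norm_nonneg u]
  have hDeq : D = ((q + 1 : ℕ) : ℓ2 V →L[ℂ] ℓ2 V) := hD.eq_natCast hreg
  have hself : IsSelfAdjoint (D - A) := by
    rw [hDeq]
    exact (IsSelfAdjoint.natCast _).sub (hA.isSelfAdjoint hfin)
  have hnormal : IsStarNormal (D - A) := hself.isStarNormal
  have hAeq : algebraMap ℂ (ℓ2 V →L[ℂ] ℓ2 V) ((q : ℂ) + 1) - (D - A) = A := by
    rw [hDeq]
    simp
  have hspec : ∀ z ∈ spectrum ℂ (D - A), ‖((q : ℂ) + 1) - z‖ ≤ q + 1 := by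
    intro z hz
    have hz' : ((q : ℂ) + 1) - z ∈ spectrum ℂ A := by
      rw [← hAeq, ← spectrum.singleton_sub_eq]
      exact Set.sub_mem_sub rfl hz
    refine (spectrum.norm_le_norm_mul_of_mem hz').trans ?_
    refine (mul_le_of_le_one_right (norm_nonneg _) ContinuousLinearMap.norm_id_le).trans ?_
    exact_mod_cast hA.norm_le hfin hreg
  have hBm : ∀ m, C (m + 1) - ((q : ℓ2 V →L[ℂ] ℓ2 V) - 1) *
      ∑ j ∈ Finset.Icc 1 ((m + 1) / 2), C (m + 1 - 2 * j) = rootPowSum q A (m + 1) :=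
    sub_mul_sum_eq_rootPowSum hC.zero (hC.one hfin hA)
      (by rw [hC.two hfin hA hreg, Nat.cast_add, Nat.cast_one]) (hC.add_three hfin hA hreg)
  have hDq : (D - 1) - 1 = (q : ℓ2 V →L[ℂ] ℓ2 V) - 1 := by
    rw [hDeq, Nat.cast_add, Nat.cast_one, add_sub_cancel_right]
  have hN : ∀ m, NX (m + 1) = rootPowSum q A (m + 1) +
      ((if Even (m + 1) then (q : ℓ2 V →L[ℂ] ℓ2 V) - 1 else 0) + R (m + 1)) := by
    intro m
    match m with
    | 0 =>
      rw [hNX, hB_small _ (by omega), hRp_small _ (by omega), hR_small _ (by omega), ← hBm]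
      simp
    | 1 =>
      rw [hNX, hB_small _ (by omega), hRp_small _ (by omega), hR_small _ (by omega), ← hBm]
      simp [hC.zero]
    | k + 2 =>
      rw [hNX, hB _ (by omega), hRp _ (by omega), hDq, hBm]
  have hsum1 : HasSum (fun m : ℕ => ent (rootPowSum q A (m + 1)) x₀ x / (m + 1) * u ^ (m + 1))
      (-ent (cfc (fun lam : ℂ =>
        Complex.log (1 - (((q : ℂ) + 1) - lam) * u + (q : ℂ) * u ^ 2)) (D - A)) x₀ x) := by
    have h := (hasSum_rootPowSum_cfc hα0 hα2 hu' (D - A) hspec).mapL (SimpleGraph.entCLM x₀ x)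
    rw [hAeq, map_neg, SimpleGraph.entCLM_apply] at h
    refine HasSum.of_forall_eq h fun m => ?_
    rw [map_smul, SimpleGraph.entCLM_apply, smul_eq_mul]
    ring
  have hentq : ent ((q : ℓ2 V →L[ℂ] ℓ2 V) - 1) x₀ x =
      ((q : ℂ) - 1) * (if x = x₀ then (1 : ℂ) else 0) := by
    have h : ent ((q : ℓ2 V →L[ℂ] ℓ2 V) - 1) x₀ x =
        (q : ℓ2 V →L[ℂ] ℓ2 V) (lp.single 2 x₀ 1) x - (lp.single 2 x₀ (1 : ℂ) : ℓ2 V) x := rfl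
    rw [h, SimpleGraph.natCast_ℓ2_apply, lp.single_apply, Pi.single_apply]
    ring
  have hsum2 := hasSum_even_pow hu1 (((q : ℂ) - 1) * (if x = x₀ then (1 : ℂ) else 0))
  have hRsum : Summable fun m : ℕ => ent (R (m + 3)) x₀ x / ((m : ℂ) + 3) * u ^ (m + 3) := by
    have hs : Summable fun m : ℕ =>
        4 * ((q : ℝ) + 1) * (((m + 3 : ℕ) : ℝ) ^ 2 * (‖u‖ * α) ^ (m + 3)) :=
      ((summable_nat_add_iff 3).2 (summable_pow_mul_geometric_of_norm_lt_one 2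
        (r := ‖u‖ * α) (by rwa [Real.norm_of_nonneg (by positivity)]))).mul_left _
    refine Summable.of_norm_bounded hs fun m => ?_
    have h1 : ‖ent (R (m + 3)) x₀ x‖ ≤
        4 * ((q : ℝ) + 1) * (((m + 3 : ℕ) : ℝ) ^ 2 * α ^ (m + 3)) := by
      rw [ent, hR _ (by omega), norm_mul]
      refine le_trans (mul_le_of_le_one_right (norm_nonneg _) ?_)
        (hC.norm_sum_mul_lapc_le hfin hA hreg hα1 hα2 (m + 3) x)
      rw [lp.single_apply, Pi.single_apply]
      split_ifs <;> simp
    have h2 : (1 : ℝ) ≤ ‖(m : ℂ) + 3‖ := by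
      have : ‖((m + 3 : ℕ) : ℂ)‖ = ((m + 3 : ℕ) : ℝ) := Complex.norm_natCast _
      push_cast at this
      rw [this]
      linarith [(Nat.cast_nonneg m : (0 : ℝ) ≤ m)]
    rw [norm_mul, norm_div, norm_pow]
    calc _ ≤ 4 * ((q : ℝ) + 1) * (((m + 3 : ℕ) : ℝ) ^ 2 * α ^ (m + 3)) * ‖u‖ ^ (m + 3) := by
          gcongr
          exact (div_le_self (norm_nonneg _) h2).trans h1
      _ = _ := by rw [mul_pow]; ring
  have hsum3 : HasSum (fun m : ℕ => ent (R (m + 1)) x₀ x / ((m : ℂ) + 1) * u ^ (m + 1))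
      (∑' m : ℕ, ent (R (m + 3)) x₀ x / ((m : ℂ) + 3) * u ^ (m + 3)) := by
    refine (hasSum_nat_add_iff' 2).1 ?_
    have h0 : ent (0 : ℓ2 V →L[ℂ] ℓ2 V) x₀ x = 0 := rfl
    simp only [Finset.sum_range_succ, Finset.sum_range_zero, hR_small 1 (by omega),
      hR_small 2 (by omega), Nat.reduceAdd, h0, zero_div, zero_mul, add_zero, zero_add, sub_zero]
    refine HasSum.of_forall_eq hRsum.hasSum fun m => ?_
    rw [show ((m + 2 : ℕ) : ℂ) + 1 = m + 3 by push_cast; ring]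
  have hw : (1 : ℂ) - u ^ 2 ≠ 0 := Complex.slitPlane_ne_zero
    (one_sub_mem_slitPlane (by rw [norm_pow]; exact pow_lt_one₀ (norm_nonneg _) hu1 two_ne_zero))
  rw [cpow_mul_exp_eq hw]
  congr 1
  refine HasSum.tsum_eq ?_
  have htotal := hsum1.add (hsum2.add hsum3)
  convert htotal using 1
  · ext m
    rw [hN, ← SimpleGraph.entCLM_apply, map_add, map_add, SimpleGraph.entCLM_apply,
      SimpleGraph.entCLM_apply, SimpleGraph.entCLM_apply]
    have h0 : ent (0 : ℓ2 V →L[ℂ] ℓ2 V) x₀ x = 0 := rfl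
    rw [apply_ite (fun T => ent T x₀ x), hentq, h0]
    ring
  · ring
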